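/- Offline performance bound with representation mismatch and entropy gap (Theorem 4): for two transition kernels P_src, P_tar with P_tar(s,a)(s') > 0 for all (s,a,s'), and two policies π_D (the empirical behavior policy of the offline source dataset) and π on the same finite state and action spaces (same reward, discount, and initial distribution), suppose R : S × A → ℝ satisfies R(s,a) ≥ 0 and R(s,a) = D_KL( P_src(s,a) ‖ P_tar(s,a) ) + H(P_src(s,a)) − H(P_tar(s,a)) for all (s,a) (R is the per-pair representation mismatch). Then J[P_tar](π) − J[P_src](π) ≥ −(4·r_max/(1−γ)²) · Σ_s ν[P_src,π_D](s) · D_TV( π_D(s), π(s) ) − (√2·γ·r_max/(1−γ)²) · Σ_{(s,a)} ρ[P_src,π_D](s,a) · √(R(s,a)) − (√2·γ·r_max/(1−γ)²) · Σ_{(s,a)} ρ[P_src,π_D](s,a) · √( |H(P_src(s,a)) − H(P_tar(s,a))| ). -/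

import Mathlib

open Real

noncomputable section

variable {S A : Type*} [Fintype S] [Fintype A]

/-- Time-`t` state-action distribution `d_t[P,pol]` started from the initial state
distribution `ρ0`:  `d_0(s,a) = ρ0(s)·pol(s)(a)` and
`d_{t+1}(s',a') = Σ_{(s,a)} d_t(s,a)·P(s,a)(s')·pol(s')(a')`. -/
def dDist (P : S → A → PMF S) (pol : S → PMF A) (ρ0 : PMF S) : ℕ → S × A → ℝ
  | 0 => fun p => (ρ0 p.1).toReal * (pol p.1 p.2).toReal
  | (t + 1) => fun p' =>
      ∑ p : S × A, dDist P pol ρ0 t p * (P p.1 p.2 p'.1).toReal * (pol p'.1 p'.2).toReal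

/-- Normalized state-action occupancy `ρ[P,pol](s,a) = (1−γ)·Σ_t γ^t·d_t[P,pol](s,a)`. -/
def occ (P : S → A → PMF S) (pol : S → PMF A) (ρ0 : PMF S) (γ : ℝ) (p : S × A) : ℝ :=
  (1 - γ) * ∑' t : ℕ, γ ^ t * dDist P pol ρ0 t p

/-- Normalized state occupancy `ν[P,pol](s) = Σ_a ρ[P,pol](s,a)`. -/
def stateOcc (P : S → A → PMF S) (pol : S → PMF A) (ρ0 : PMF S) (γ : ℝ) (s : S) : ℝ :=
  ∑ a : A, occ P pol ρ0 γ (s, a)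

/-- Expected discounted return `J[P](pol) = Σ_t γ^t Σ_{(s,a)} d_t[P,pol](s,a)·r(s,a)`. -/
def Jret (P : S → A → PMF S) (pol : S → PMF A) (ρ0 : PMF S) (r : S → A → ℝ) (γ : ℝ) : ℝ :=
  ∑' t : ℕ, γ ^ t * ∑ p : S × A, dDist P pol ρ0 t p * r p.1 p.2

/-- Value function `V[P,pol](s)`: the return with the recursion started from the point
distribution at `s` (i.e. `d_0(s',a) = 1[s'=s]·pol(s')(a)`). -/
def Vval (P : S → A → PMF S) (pol : S → PMF A) (r : S → A → ℝ) (γ : ℝ) (s : S) : ℝ :=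
  Jret P pol (PMF.pure s) r γ

/-- Action-value function `Q[P,pol](s,a) = r(s,a) + γ·Σ_{s'} P(s,a)(s')·V[P,pol](s')`. -/
def Qval (P : S → A → PMF S) (pol : S → PMF A) (r : S → A → ℝ) (γ : ℝ) (s : S) (a : A) : ℝ :=
  r s a + γ * ∑ s' : S, (P s a s').toReal * Vval P pol r γ s'

/-- Total variation distance between two pmfs on a finite type:
`D_TV(p,q) = (1/2)·Σ_x |p(x) − q(x)|`. -/
def dTV {X : Type*} [Fintype X] (p q : PMF X) : ℝ :=
  (1 / 2) * ∑ x : X, |(p x).toReal - (q x).toReal|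

/-- Kullback–Leibler divergence between two pmfs on a finite type (with `q` everywhere
positive): `D_KL(p‖q) = Σ_x p(x)·log(p(x)/q(x))`, with the convention `0·log 0 = 0`. -/
def dKL {X : Type*} [Fintype X] (p q : PMF X) : ℝ :=
  ∑ x : X, (p x).toReal * Real.log ((p x).toReal / (q x).toReal)

/-- Shannon entropy of a pmf on a finite type, `H(p) = −Σ_x p(x)·log p(x)`,
with the convention `0·log 0 = 0`. -/
def entropyPMF {X : Type*} [Fintype X] (p : PMF X) : ℝ :=
  - ∑ x : X, (p x).toReal * Real.log (p x).toReal

end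

theorem PMF.sum_toReal_eq_one {X : Type*} [Fintype X] (p : PMF X) :
    ∑ x, (p x).toReal = 1 := by
  rw [← ENNReal.toReal_sum fun x _ => p.apply_ne_top x, ← tsum_fintype (L := .unconditional X),
    p.tsum_coe, ENNReal.toReal_one]

/-- A pmf average of a bounded function obeys the same bound. -/
theorem abs_sum_toReal_mul_le {X : Type*} [Fintype X] (p : PMF X) (f : X → ℝ) (C : ℝ)
    (hf : ∀ x, |f x| ≤ C) : |∑ x, (p x).toReal * f x| ≤ C := by
  calc |∑ x, (p x).toReal * f x| ≤ ∑ x, |(p x).toReal * f x| := Finset.abs_sum_le_sum_abs _ _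
    _ ≤ ∑ x, (p x).toReal * C := by
        refine Finset.sum_le_sum fun x _ => ?_
        rw [abs_mul, abs_of_nonneg ENNReal.toReal_nonneg]
        exact mul_le_mul_of_nonneg_left (hf x) ENNReal.toReal_nonneg
    _ = C := by rw [← Finset.sum_mul, p.sum_toReal_eq_one, one_mul]

/-- Pairing the difference of two pmfs with a bounded function costs at most
twice the bound times the total variation distance. -/
theorem abs_sum_sub_mul_le_dTV {X : Type*} [Fintype X] (p q : PMF X) (f : X → ℝ) (C : ℝ)
    (hf : ∀ x, |f x| ≤ C) :
    |∑ x, ((p x).toReal - (q x).toReal) * f x| ≤ 2 * C * dTV p q := by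
  calc |∑ x, ((p x).toReal - (q x).toReal) * f x|
      ≤ ∑ x, |((p x).toReal - (q x).toReal) * f x| := Finset.abs_sum_le_sum_abs _ _
    _ ≤ ∑ x, |(p x).toReal - (q x).toReal| * C := by
        refine Finset.sum_le_sum fun x _ => ?_
        rw [abs_mul]
        exact mul_le_mul_of_nonneg_left (hf x) (abs_nonneg _)
    _ = 2 * C * dTV p q := by rw [← Finset.sum_mul, dTV]; ring

theorem hasDerivAt_log_sub_rational {x : ℝ} (hx : 0 < x) :
    HasDerivAt (fun y : ℝ => Real.log y - (y - 1) * (5 * y + 1) / (2 * y * (y + 2)))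
      ((x - 1) ^ 3 / (x ^ 2 * (x + 2) ^ 2)) x := by
  have hden : 2 * x * (x + 2) ≠ 0 := by positivity
  have h2 : HasDerivAt (fun y : ℝ => (y - 1) * (5 * y + 1))
      (1 * (5 * x + 1) + (x - 1) * (5 * 1)) x :=
    ((hasDerivAt_id' x).sub_const 1).mul (((hasDerivAt_id' x).const_mul 5).add_const 1)
  have h3 : HasDerivAt (fun y : ℝ => 2 * y * (y + 2)) (2 * 1 * (x + 2) + 2 * x * 1) x :=
    ((hasDerivAt_id' x).const_mul 2).mul ((hasDerivAt_id' x).add_const 2)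
  refine ((Real.hasDerivAt_log hx.ne').sub (h2.div h3 hden)).congr_deriv ?_
  field_simp
  ring

/-- A rational lower bound for the logarithm, exact to third order at `1`. -/
theorem rational_le_log {x : ℝ} (hx : 0 < x) :
    (x - 1) * (5 * x + 1) / (2 * x * (x + 2)) ≤ Real.log x := by
  set g : ℝ → ℝ := fun y => Real.log y - (y - 1) * (5 * y + 1) / (2 * y * (y + 2)) with hg
  have hd : ∀ y : ℝ, 0 < y → HasDerivAt g ((y - 1) ^ 3 / (y ^ 2 * (y + 2) ^ 2)) y :=
    fun y hy => hasDerivAt_log_sub_rational hy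
  have hone : g 1 = 0 := by simp [hg]
  suffices 0 ≤ g x by simpa [hg] using this
  rw [← hone]
  rcases le_total x 1 with h | h
  · have hanti : AntitoneOn g (Set.Icc x 1) := by
      refine antitoneOn_of_deriv_nonpos (convex_Icc x 1)
        (fun y hy => (hd y (hx.trans_le hy.1)).continuousAt.continuousWithinAt)
        (fun y hy => ?_) (fun y hy => ?_) <;> rw [interior_Icc] at hy
      · exact (hd y (hx.trans hy.1)).differentiableAt.differentiableWithinAt
      · rw [(hd y (hx.trans hy.1)).deriv]
        refine div_nonpos_of_nonpos_of_nonneg ?_ (by positivity)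
        exact (Odd.pow_nonpos_iff (by decide)).2 (by linarith [hy.2])
    exact hanti ⟨le_rfl, h⟩ ⟨h, le_rfl⟩ h
  · have hmono : MonotoneOn g (Set.Icc 1 x) := by
      refine monotoneOn_of_deriv_nonneg (convex_Icc 1 x)
        (fun y hy => (hd y (one_pos.trans_le hy.1)).continuousAt.continuousWithinAt)
        (fun y hy => ?_) (fun y hy => ?_) <;> rw [interior_Icc] at hy
      · exact (hd y (one_pos.trans hy.1)).differentiableAt.differentiableWithinAt
      · rw [(hd y (one_pos.trans hy.1)).deriv]
        have : 0 ≤ y - 1 := by linarith [hy.1]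
        positivity
    exact hmono ⟨le_rfl, h⟩ ⟨h, le_rfl⟩ h

theorem sq_sub_le_mul_log_div {p q : ℝ} (hp : 0 ≤ p) (hq : 0 < q) :
    (p - q) ^ 2 ≤ (2 * p + 4 * q) / 3 * (p * Real.log (p / q) - p + q) := by
  rcases hp.eq_or_lt with rfl | hp
  · simp only [zero_div, zero_mul]
    nlinarith [sq_nonneg q]
  · have h := mul_le_mul_of_nonneg_left (rational_le_log (div_pos hp hq))
      (by positivity : 0 ≤ (2 * p + 4 * q) / 3 * p)
    have hrat : (2 * p + 4 * q) / 3 * p *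
        ((p / q - 1) * (5 * (p / q) + 1) / (2 * (p / q) * (p / q + 2)))
        = (p - q) * (5 * p + q) / 3 := by
      field_simp
      ring
    rw [hrat] at h
    nlinarith [h]

/-- **Pinsker's inequality** on a finite type. -/
theorem dTV_le_sqrt_dKL_div_two {X : Type*} [Fintype X] (p q : PMF X) (hq : ∀ x, 0 < q x) :
    dTV p q ≤ √(dKL p q / 2) := by
  have hq' : ∀ x, 0 < (q x).toReal := fun x => ENNReal.toReal_pos (hq x).ne' (q.apply_ne_top x)
  have hle : ∀ x, ((p x).toReal - (q x).toReal) ^ 2 ≤ (2 * (p x).toReal + 4 * (q x).toReal) / 3 *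
      ((p x).toReal * Real.log ((p x).toReal / (q x).toReal) - (p x).toReal + (q x).toReal) :=
    fun x => sq_sub_le_mul_log_div ENNReal.toReal_nonneg (hq' x)
  have hw : ∀ x, 0 < (2 * (p x).toReal + 4 * (q x).toReal) / 3 := fun x => by
    have : 0 ≤ (p x).toReal := ENNReal.toReal_nonneg
    have := hq' x
    positivity
  have hcs := Finset.sum_sq_le_sum_mul_sum_of_sq_le_mul Finset.univ
    (r := fun x => |(p x).toReal - (q x).toReal|)
    (fun x _ => (hw x).le)
    (fun x _ => nonneg_of_mul_nonneg_right ((sq_nonneg _).trans (hle x)) (hw x))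
    (fun x _ => by rw [sq_abs]; exact hle x)
  have hW : ∑ x, (2 * (p x).toReal + 4 * (q x).toReal) / 3 = 2 := by
    rw [← Finset.sum_div, Finset.sum_add_distrib, ← Finset.mul_sum, ← Finset.mul_sum,
      p.sum_toReal_eq_one, q.sum_toReal_eq_one]
    norm_num
  rw [hW, Finset.sum_add_distrib, Finset.sum_sub_distrib, p.sum_toReal_eq_one,
    q.sum_toReal_eq_one] at hcs
  refine Real.le_sqrt_of_sq_le ?_
  rw [dTV, dKL]
  nlinarith [hcs]

section Occupancy

variable {S A : Type*} [Fintype S] [Fintype A]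
  (P P' : S → A → PMF S) (pol pol' : S → PMF A) (ρ0 : PMF S) (r : S → A → ℝ) (γ : ℝ)

theorem dDist_nonneg (t : ℕ) (p : S × A) : 0 ≤ dDist P pol ρ0 t p := by
  induction t generalizing p with
  | zero => exact mul_nonneg ENNReal.toReal_nonneg ENNReal.toReal_nonneg
  | succ t ih =>
    exact Finset.sum_nonneg fun q _ =>
      mul_nonneg (mul_nonneg (ih q) ENNReal.toReal_nonneg) ENNReal.toReal_nonneg

theorem sum_dDist_zero_mul (V : S → ℝ) :
    ∑ p, dDist P pol ρ0 0 p * V p.1 = ∑ s, (ρ0 s).toReal * V s := by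
  rw [Fintype.sum_prod_type]
  refine Finset.sum_congr rfl fun s _ => ?_
  simp only [dDist]
  rw [← Finset.sum_mul, ← Finset.mul_sum, (pol s).sum_toReal_eq_one, mul_one]

theorem sum_dDist_succ_mul (V : S → ℝ) (t : ℕ) :
    ∑ p, dDist P pol ρ0 (t + 1) p * V p.1 =
      ∑ p, dDist P pol ρ0 t p * ∑ s', (P p.1 p.2 s').toReal * V s' := by
  simp only [dDist, Finset.mul_sum, Finset.sum_mul]
  rw [Finset.sum_comm]
  refine Finset.sum_congr rfl fun p _ => ?_
  rw [Fintype.sum_prod_type]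
  refine Finset.sum_congr rfl fun s _ => ?_
  calc ∑ a, dDist P pol ρ0 t p * (P p.1 p.2 s).toReal * (pol s a).toReal * V s
      = dDist P pol ρ0 t p * (P p.1 p.2 s).toReal * (∑ a, (pol s a).toReal) * V s := by
        rw [Finset.mul_sum, Finset.sum_mul]
    _ = _ := by rw [(pol s).sum_toReal_eq_one]; ring

theorem sum_dDist (t : ℕ) : ∑ p, dDist P pol ρ0 t p = 1 := by
  induction t with
  | zero =>
    have := sum_dDist_zero_mul P pol ρ0 fun _ => 1
    simpa [ρ0.sum_toReal_eq_one] using this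
  | succ t ih =>
    have := sum_dDist_succ_mul P pol ρ0 (fun _ => 1) t
    simpa [PMF.sum_toReal_eq_one, ih] using this

theorem dDist_le_one (t : ℕ) (p : S × A) : dDist P pol ρ0 t p ≤ 1 := by
  rw [← sum_dDist P pol ρ0 t]
  exact Finset.single_le_sum (fun q _ => dDist_nonneg P pol ρ0 t q) (Finset.mem_univ p)

theorem dDist_eq_sum_mul (t : ℕ) (s : S) (a : A) :
    dDist P pol ρ0 t (s, a) = (∑ b, dDist P pol ρ0 t (s, b)) * (pol s a).toReal := by
  cases t with
  | zero => simp only [dDist]; rw [← Finset.mul_sum, (pol s).sum_toReal_eq_one, mul_one]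
  | succ t =>
    simp only [dDist, ← Finset.sum_mul]
    rw [← Finset.mul_sum, (pol s).sum_toReal_eq_one, mul_one]

variable {γ}

theorem summable_pow_mul_dDist (hγ0 : 0 ≤ γ) (hγ1 : γ < 1) (p : S × A) :
    Summable fun t : ℕ => γ ^ t * dDist P pol ρ0 t p :=
  (summable_geometric_of_lt_one hγ0 hγ1).of_nonneg_of_le
    (fun t => mul_nonneg (pow_nonneg hγ0 t) (dDist_nonneg P pol ρ0 t p))
    (fun t => mul_le_of_le_one_right (pow_nonneg hγ0 t) (dDist_le_one P pol ρ0 t p))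

theorem summable_pow_mul_sum_dDist_mul (hγ0 : 0 ≤ γ) (hγ1 : γ < 1) (f : S × A → ℝ) :
    Summable fun t : ℕ => γ ^ t * ∑ p, dDist P pol ρ0 t p * f p := by
  simp only [Finset.mul_sum, ← mul_assoc]
  exact summable_sum fun p _ => (summable_pow_mul_dDist P pol ρ0 hγ0 hγ1 p).mul_right (f p)

theorem occ_nonneg (hγ0 : 0 ≤ γ) (hγ1 : γ < 1) (p : S × A) : 0 ≤ occ P pol ρ0 γ p :=
  mul_nonneg (by linarith)
    (tsum_nonneg fun t => mul_nonneg (pow_nonneg hγ0 t) (dDist_nonneg P pol ρ0 t p))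

theorem stateOcc_nonneg (hγ0 : 0 ≤ γ) (hγ1 : γ < 1) (s : S) : 0 ≤ stateOcc P pol ρ0 γ s :=
  Finset.sum_nonneg fun a _ => occ_nonneg P pol ρ0 hγ0 hγ1 (s, a)

theorem occ_eq_stateOcc_mul (hγ0 : 0 ≤ γ) (hγ1 : γ < 1) (s : S) (a : A) :
    occ P pol ρ0 γ (s, a) = stateOcc P pol ρ0 γ s * (pol s a).toReal := by
  simp only [stateOcc, occ]
  rw [← Finset.mul_sum,
    ← Summable.tsum_finsetSum fun b _ => summable_pow_mul_dDist P pol ρ0 hγ0 hγ1 (s, b),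
    mul_assoc, ← tsum_mul_right]
  congr 1
  refine tsum_congr fun t => ?_
  rw [dDist_eq_sum_mul, ← Finset.mul_sum, mul_assoc]

theorem sum_occ_mul (hγ0 : 0 ≤ γ) (hγ1 : γ < 1) (f : S × A → ℝ) :
    ∑ p, occ P pol ρ0 γ p * f p =
      (1 - γ) * ∑' t : ℕ, γ ^ t * ∑ p, dDist P pol ρ0 t p * f p := by
  simp only [occ, Finset.mul_sum, ← mul_assoc]
  rw [Summable.tsum_finsetSum fun p _ =>
    (summable_pow_mul_dDist P pol ρ0 hγ0 hγ1 p).mul_right (f p), Finset.mul_sum]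
  refine Finset.sum_congr rfl fun p _ => ?_
  rw [tsum_mul_right, mul_assoc]

theorem sum_occ_mul_reward (hγ0 : 0 ≤ γ) (hγ1 : γ < 1) :
    ∑ p, occ P pol ρ0 γ p * r p.1 p.2 = (1 - γ) * Jret P pol ρ0 r γ :=
  sum_occ_mul P pol ρ0 hγ0 hγ1 fun p => r p.1 p.2

/-- The Bellman flow equation of the occupancy measure, tested against a function of the state. -/
theorem sum_occ_mul_sub (hγ0 : 0 ≤ γ) (hγ1 : γ < 1) (V : S → ℝ) :
    ∑ p, occ P pol ρ0 γ p * (V p.1 - γ * ∑ s', (P p.1 p.2 s').toReal * V s') =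
      (1 - γ) * ∑ s, (ρ0 s).toReal * V s := by
  have hV := summable_pow_mul_sum_dDist_mul P pol ρ0 hγ0 hγ1 fun p => V p.1
  simp only [mul_sub, Finset.sum_sub_distrib]
  rw [sum_occ_mul P pol ρ0 hγ0 hγ1 (fun p => V p.1),
    sum_occ_mul P pol ρ0 hγ0 hγ1 (fun p => γ * ∑ s', (P p.1 p.2 s').toReal * V s'),
    hV.tsum_eq_zero_add, sum_dDist_zero_mul]
  have hshift : ∀ t : ℕ, γ ^ (t + 1) * ∑ p, dDist P pol ρ0 (t + 1) p * V p.1 =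
      γ ^ t * ∑ p, dDist P pol ρ0 t p * (γ * ∑ s', (P p.1 p.2 s').toReal * V s') := fun t => by
    rw [sum_dDist_succ_mul, pow_succ, mul_assoc, Finset.mul_sum Finset.univ _ γ]
    congr 1
    exact Finset.sum_congr rfl fun p _ => by ring
  rw [tsum_congr hshift]
  ring

/-- The Bellman equation of a policy has a solution. -/
theorem exists_bellman_solution (hγ0 : 0 ≤ γ) (hγ1 : γ < 1) :
    ∃ V : S → ℝ, ∀ s, V s = ∑ a, (pol s a).toReal *
      (r s a + γ * ∑ s', (P s a s').toReal * V s') := by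
  set T : (S → ℝ) → S → ℝ := fun V s => ∑ a, (pol s a).toReal *
    (r s a + γ * ∑ s', (P s a s').toReal * V s') with hT
  have hlip : ContractingWith ⟨γ, hγ0⟩ T := by
    refine ⟨hγ1, LipschitzWith.of_dist_le_mul fun V W => ?_⟩
    refine (dist_pi_le_iff (mul_nonneg hγ0 dist_nonneg)).2 fun s => ?_
    have hdiff : T V s - T W s =
        ∑ a, (pol s a).toReal * (γ * ∑ s', (P s a s').toReal * (V s' - W s')) := by
      simp only [hT, ← Finset.sum_sub_distrib]
      refine Finset.sum_congr rfl fun a _ => ?_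
      simp only [mul_sub, Finset.sum_sub_distrib]
      ring
    rw [Real.dist_eq, hdiff]
    refine abs_sum_toReal_mul_le _ _ _ fun a => ?_
    rw [abs_mul, abs_of_nonneg hγ0]
    refine mul_le_mul_of_nonneg_left (abs_sum_toReal_mul_le _ _ _ fun s' => ?_) hγ0
    rw [← Real.dist_eq]
    exact dist_le_pi_dist V W s'
  exact ⟨hlip.fixedPoint T, fun s => (congrFun hlip.fixedPoint_isFixedPt s).symm⟩

variable {r} in
theorem abs_le_of_bellman (hγ0 : 0 ≤ γ) (hγ1 : γ < 1) {C : ℝ} (hr : ∀ s a, |r s a| ≤ C)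
    {V : S → ℝ} (hV : ∀ s, V s = ∑ a, (pol s a).toReal *
      (r s a + γ * ∑ s', (P s a s').toReal * V s')) (s : S) :
    |V s| ≤ C / (1 - γ) := by
  have : Nonempty S := ⟨s⟩
  obtain ⟨m, hm⟩ := Finite.exists_max fun s => |V s|
  have hstep : |V m| ≤ C + γ * |V m| := by
    conv_lhs => rw [hV m]
    refine abs_sum_toReal_mul_le _ _ _ fun a => (abs_add_le _ _).trans (add_le_add (hr m a) ?_)
    rw [abs_mul, abs_of_nonneg hγ0]
    exact mul_le_mul_of_nonneg_left (abs_sum_toReal_mul_le _ _ _ hm) hγ0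
  refine (hm s).trans ?_
  rw [le_div_iff₀ (by linarith)]
  linarith

/-- The return is the initial average of any solution of the Bellman equation. -/
theorem Jret_eq_of_bellman (hγ0 : 0 ≤ γ) (hγ1 : γ < 1) {V : S → ℝ}
    (hV : ∀ s, V s = ∑ a, (pol s a).toReal *
      (r s a + γ * ∑ s', (P s a s').toReal * V s')) :
    Jret P pol ρ0 r γ = ∑ s, (ρ0 s).toReal * V s := by
  refine mul_left_cancel₀ (sub_pos.2 hγ1).ne' ?_
  rw [← sum_occ_mul_sub P pol ρ0 hγ0 hγ1 V, ← sum_occ_mul_reward P pol ρ0 r hγ0 hγ1,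
    ← sub_eq_zero, ← Finset.sum_sub_distrib, Fintype.sum_prod_type]
  refine Finset.sum_eq_zero fun s _ => ?_
  have hs : ∀ a, occ P pol ρ0 γ (s, a) * r s a - occ P pol ρ0 γ (s, a) *
      (V s - γ * ∑ s', (P s a s').toReal * V s') = stateOcc P pol ρ0 γ s *
      ((pol s a).toReal * (r s a + γ * ∑ s', (P s a s').toReal * V s')
        - (pol s a).toReal * V s) := fun a => by
    rw [occ_eq_stateOcc_mul P pol ρ0 hγ0 hγ1]
    ring
  simp only [hs]
  rw [← Finset.mul_sum, Finset.sum_sub_distrib, ← hV, ← Finset.sum_mul,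
    PMF.sum_toReal_eq_one, one_mul, sub_self, mul_zero]

/-- Performance difference when both the kernel and the policy change, in terms of a solution `V`
of the Bellman equation for the second pair. -/
theorem Jret_sub_eq_of_bellman (hγ0 : 0 ≤ γ) (hγ1 : γ < 1) {V : S → ℝ}
    (hV : ∀ s, V s = ∑ a, (pol' s a).toReal *
      (r s a + γ * ∑ s', (P' s a s').toReal * V s')) :
    (1 - γ) * (Jret P pol ρ0 r γ - Jret P' pol' ρ0 r γ) =
      γ * (∑ p, occ P pol ρ0 γ p *
        ∑ s', ((P p.1 p.2 s').toReal - (P' p.1 p.2 s').toReal) * V s') +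
      ∑ s, stateOcc P pol ρ0 γ s * ∑ a, ((pol s a).toReal - (pol' s a).toReal) *
        (r s a + γ * ∑ s', (P' s a s').toReal * V s') := by
  rw [Jret_eq_of_bellman P' pol' ρ0 r hγ0 hγ1 hV, mul_sub,
    ← sum_occ_mul_sub P pol ρ0 hγ0 hγ1 V, ← sum_occ_mul_reward P pol ρ0 r hγ0 hγ1,
    ← Finset.sum_sub_distrib, Finset.mul_sum, Fintype.sum_prod_type, Fintype.sum_prod_type,
    ← Finset.sum_add_distrib]
  refine Finset.sum_congr rfl fun s _ => ?_
  simp only [occ_eq_stateOcc_mul P pol ρ0 hγ0 hγ1]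
  simp only [sub_mul, Finset.sum_sub_distrib]
  rw [← hV s]
  have hone : V s = ∑ a, (pol s a).toReal * V s := by
    rw [← Finset.sum_mul, PMF.sum_toReal_eq_one, one_mul]
  conv_rhs => rw [hone]
  rw [← Finset.sum_sub_distrib, ← Finset.sum_sub_distrib, Finset.mul_sum,
    ← Finset.sum_add_distrib]
  exact Finset.sum_congr rfl fun a _ => by ring

variable {r} in
theorem abs_Jret_sub_le (hγ0 : 0 ≤ γ) (hγ1 : γ < 1) {C : ℝ} (hr : ∀ s a, |r s a| ≤ C) :
    |Jret P pol ρ0 r γ - Jret P' pol' ρ0 r γ| ≤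
      2 * C / (1 - γ) ^ 2 * (γ * (∑ p, occ P pol ρ0 γ p * dTV (P p.1 p.2) (P' p.1 p.2)) +
        ∑ s, stateOcc P pol ρ0 γ s * dTV (pol s) (pol' s)) := by
  obtain ⟨V, hV⟩ := exists_bellman_solution P' pol' r hγ0 hγ1
  have hVle := abs_le_of_bellman P' pol' hγ0 hγ1 hr hV
  have hpos : 0 < 1 - γ := sub_pos.2 hγ1
  have hQle : ∀ s a, |r s a + γ * ∑ s', (P' s a s').toReal * V s'| ≤ C / (1 - γ) := fun s a => by
    have hC : C + γ * (C / (1 - γ)) = C / (1 - γ) := by field_simp; ring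
    rw [← hC]
    refine (abs_add_le _ _).trans (add_le_add (hr s a) ?_)
    rw [abs_mul, abs_of_nonneg hγ0]
    exact mul_le_mul_of_nonneg_left (abs_sum_toReal_mul_le _ _ _ hVle) hγ0
  have hker : |∑ p, occ P pol ρ0 γ p *
      ∑ s', ((P p.1 p.2 s').toReal - (P' p.1 p.2 s').toReal) * V s'| ≤
      2 * (C / (1 - γ)) * ∑ p, occ P pol ρ0 γ p * dTV (P p.1 p.2) (P' p.1 p.2) := by
    rw [Finset.mul_sum]
    refine (Finset.abs_sum_le_sum_abs _ _).trans (Finset.sum_le_sum fun p _ => ?_)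
    have h0 := occ_nonneg P pol ρ0 hγ0 hγ1 p
    rw [abs_mul, abs_of_nonneg h0, mul_left_comm]
    exact mul_le_mul_of_nonneg_left (abs_sum_sub_mul_le_dTV _ _ _ _ hVle) h0
  have hpol : |∑ s, stateOcc P pol ρ0 γ s * ∑ a, ((pol s a).toReal - (pol' s a).toReal) *
        (r s a + γ * ∑ s', (P' s a s').toReal * V s')| ≤
      2 * (C / (1 - γ)) * ∑ s, stateOcc P pol ρ0 γ s * dTV (pol s) (pol' s) := by
    rw [Finset.mul_sum]
    refine (Finset.abs_sum_le_sum_abs _ _).trans (Finset.sum_le_sum fun s _ => ?_)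
    have h0 := stateOcc_nonneg P pol ρ0 hγ0 hγ1 s
    rw [abs_mul, abs_of_nonneg h0, mul_left_comm]
    exact mul_le_mul_of_nonneg_left (abs_sum_sub_mul_le_dTV _ _ _ _ (hQle s)) h0
  refine le_of_mul_le_mul_left ?_ hpos
  rw [← abs_of_pos hpos, ← abs_mul, abs_of_pos hpos,
    Jret_sub_eq_of_bellman P P' pol pol' ρ0 r hγ0 hγ1 hV]
  refine (abs_add_le _ _).trans ((add_le_add ?_ hpol).trans_eq
    (b := γ * (2 * (C / (1 - γ)) * ∑ p, occ P pol ρ0 γ p * dTV (P p.1 p.2) (P' p.1 p.2)) + _) ?_)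
  · rw [abs_mul, abs_of_nonneg hγ0]
    exact mul_le_mul_of_nonneg_left hker hγ0
  · field_simp

end Occupancy

theorem dTV_self {X : Type*} [Fintype X] (p : PMF X) : dTV p p = 0 := by
  simp [dTV]

/-- Pinsker's inequality with the divergence split into a representation mismatch and an
entropy gap. -/
theorem two_mul_dTV_le_of_eq_dKL_add {X : Type*} [Fintype X] (p q : PMF X) (hq : ∀ x, 0 < q x)
    {R : ℝ} (hR0 : 0 ≤ R) (hR : R = dKL p q + entropyPMF p - entropyPMF q) :
    2 * dTV p q ≤ √2 * (√R + √|entropyPMF p - entropyPMF q|) := by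
  have hKL : dKL p q ≤ R + |entropyPMF p - entropyPMF q| := by
    linarith [neg_abs_le (entropyPMF p - entropyPMF q)]
  calc 2 * dTV p q ≤ 2 * √(dKL p q / 2) := by
        linarith [dTV_le_sqrt_dKL_div_two p q hq]
    _ = √2 * √(dKL p q) := by
        rw [Real.sqrt_div' _ zero_le_two]
        have h2 : √2 * √2 = 2 := Real.mul_self_sqrt zero_le_two
        field_simp
        rw [sq, h2, mul_comm]
    _ ≤ √2 * (√R + √|entropyPMF p - entropyPMF q|) := by
        refine mul_le_mul_of_nonneg_left ?_ (Real.sqrt_nonneg 2)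
        refine Real.sqrt_le_iff.2 ⟨by positivity, hKL.trans ?_⟩
        rw [add_sq, Real.sq_sqrt hR0, Real.sq_sqrt (abs_nonneg _)]
        have : 0 ≤ 2 * √R * √|entropyPMF p - entropyPMF q| := by positivity
        linarith

/-- offline performance bound with representation mismatch and entropy
gap, Theorem 4: given a nonnegative per-pair representation mismatch
`R(s,a) = D_KL(P_src(s,a)‖P_tar(s,a)) + H(P_src(s,a)) − H(P_tar(s,a))`, for kernels
`P_src, P_tar` (with `P_tar` everywhere positive) and policies `pol_D, pol`,
`J[P_tar](pol) − J[P_src](pol) ≥ −(4·r_max/(1−γ)²) Σ_s ν[P_src,pol_D](s)·D_TV(pol_D(s), pol(s))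
 − (√2·γ·r_max/(1−γ)²) Σ ρ[P_src,pol_D]·√R
 − (√2·γ·r_max/(1−γ)²) Σ ρ[P_src,pol_D]·√|H(P_src) − H(P_tar)|`. -/
theorem offline_performance_bound_representation
    {S A : Type*} [Fintype S] [Fintype A] [Nonempty S] [Nonempty A]
    (Psrc Ptar : S → A → PMF S) (hpos : ∀ s a s', 0 < Ptar s a s')
    (R : S × A → ℝ) (hR0 : ∀ p : S × A, 0 ≤ R p)
    (hR : ∀ p : S × A, R p = dKL (Psrc p.1 p.2) (Ptar p.1 p.2)
      + entropyPMF (Psrc p.1 p.2) - entropyPMF (Ptar p.1 p.2))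
    (polD pol : S → PMF A) (ρ0 : PMF S)
    (r : S → A → ℝ) (rmax : ℝ) (hrmax : 0 ≤ rmax) (hr : ∀ s a, |r s a| ≤ rmax)
    (γ : ℝ) (hγ0 : 0 ≤ γ) (hγ1 : γ < 1) :
    Jret Ptar pol ρ0 r γ - Jret Psrc pol ρ0 r γ ≥
      -(4 * rmax / (1 - γ) ^ 2) *
        (∑ s : S, stateOcc Psrc polD ρ0 γ s * dTV (polD s) (pol s))
      - (Real.sqrt 2 * γ * rmax / (1 - γ) ^ 2) *
        (∑ p : S × A, occ Psrc polD ρ0 γ p * Real.sqrt (R p))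
      - (Real.sqrt 2 * γ * rmax / (1 - γ) ^ 2) *
        ∑ p : S × A, occ Psrc polD ρ0 γ p *
          Real.sqrt |entropyPMF (Psrc p.1 p.2) - entropyPMF (Ptar p.1 p.2)| := by
  have hpos' : 0 < 1 - γ := sub_pos.2 hγ1
  have hpol := neg_abs_le (Jret Psrc polD ρ0 r γ - Jret Psrc pol ρ0 r γ)
  have hpol' := abs_Jret_sub_le Psrc Psrc polD pol ρ0 hγ0 hγ1 hr
  have hboth := le_abs_self (Jret Psrc polD ρ0 r γ - Jret Ptar pol ρ0 r γ)
  have hboth' := abs_Jret_sub_le Psrc Ptar polD pol ρ0 hγ0 hγ1 hr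
  simp only [dTV_self, mul_zero, Finset.sum_const_zero, zero_add] at hpol'
  have hker : 2 * ∑ p, occ Psrc polD ρ0 γ p * dTV (Psrc p.1 p.2) (Ptar p.1 p.2) ≤
      √2 * ((∑ p, occ Psrc polD ρ0 γ p * √(R p)) + ∑ p, occ Psrc polD ρ0 γ p *
        √|entropyPMF (Psrc p.1 p.2) - entropyPMF (Ptar p.1 p.2)|) := by
    rw [← Finset.sum_add_distrib, Finset.mul_sum, Finset.mul_sum]
    refine Finset.sum_le_sum fun p _ => ?_
    rw [← mul_add, mul_left_comm, mul_left_comm √2]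
    exact mul_le_mul_of_nonneg_left
      (two_mul_dTV_le_of_eq_dKL_add _ _ (hpos p.1 p.2) (hR0 p) (hR p))
      (occ_nonneg Psrc polD ρ0 hγ0 hγ1 p)
  have hscaled := mul_le_mul_of_nonneg_left hker
    (by positivity : 0 ≤ γ * rmax / (1 - γ) ^ 2)
  linear_combination hpol + hpol' + hboth + hboth' + hscaled
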